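/- arXiv:1604.02036 — 2 statements merged into one kernel-verified Lean document; each statement's English description precedes it below -/
import Mathlib

section
/- For every ε > 0 and every positive integer m there exists a constant C(ε, m) such that for every finite set S₀ of prime numbers, ∑_χ |L^{S₀}(1, χ)|^m ≤ C(ε, m) · ∏_{p ∈ S₀} p^{ε}, where the sum runs over all nontrivial primitive quadratic Dirichlet characters χ whose conductor is divisible only by primes belonging to S₀, and L^{S₀}(1, χ) := L(1, χ) · ∏_{p ∈ S₀} (1 − χ(p) p^{−1}) is the value at s = 1 of the Dirichlet L-function of χ with the Euler factors at primes of S₀ removed. -/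
open Filter Topology in
lemma exists_const_pow_card_le_prod_rpow (A : ℝ) (hA : 1 ≤ A) {δ : ℝ} (hδ : 0 < δ) :
    ∃ C : ℝ, 0 < C ∧ ∀ S : Finset ℕ, (∀ p ∈ S, 1 ≤ p) →
      A ^ S.card ≤ C * ∏ p ∈ S, (p : ℝ) ^ δ := by
  obtain ⟨P, hP⟩ := eventually_atTop.mp
    (((tendsto_rpow_atTop hδ).comp tendsto_natCast_atTop_atTop).eventually_ge_atTop A)
  refine ⟨A ^ P, by positivity, fun S hS ↦ ?_⟩
  have hcard : (S.filter (· < P)).card ≤ P := by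
    simpa using Finset.card_le_card
      (show S.filter (· < P) ⊆ Finset.range P from fun p hp ↦ by simp_all)
  calc A ^ S.card = ∏ p ∈ S, A := by simp
    _ ≤ ∏ p ∈ S, ((if p < P then A else 1) * (p : ℝ) ^ δ) := by
        refine Finset.prod_le_prod (fun _ _ ↦ by positivity) fun p hp ↦ ?_
        have h1 : 1 ≤ (p : ℝ) ^ δ := Real.one_le_rpow (by exact_mod_cast hS p hp) hδ.le
        split_ifs with h
        · exact le_mul_of_one_le_right (by positivity) h1
        · simpa using hP p (not_lt.mp h)
    _ = A ^ (S.filter (· < P)).card * ∏ p ∈ S, (p : ℝ) ^ δ := by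
        rw [Finset.prod_mul_distrib, ← Finset.prod_filter, Finset.prod_const]
    _ ≤ A ^ P * ∏ p ∈ S, (p : ℝ) ^ δ := by gcongr

lemma norm_sum_range_le_of_periodic {g : ℕ → ℂ} {M : ℕ} (hM : 0 < M)
    (hg : Function.Periodic g M) (hsum : ∑ k ∈ Finset.range M, g k = 0)
    (hle : ∀ k, ‖g k‖ ≤ 1) (n : ℕ) : ‖∑ k ∈ Finset.range n, g k‖ ≤ M := by
  induction n using Nat.strong_induction_on with
  | _ n ih =>
    rcases lt_or_ge n M with h | h
    · calc ‖∑ k ∈ Finset.range n, g k‖ ≤ ∑ k ∈ Finset.range n, (1 : ℝ) :=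
            norm_sum_le_of_le _ fun k _ ↦ hle k
        _ ≤ M := by simpa using h.le
    · obtain ⟨r, rfl⟩ := Nat.exists_eq_add_of_le h
      rw [Finset.sum_range_add, hsum, zero_add]
      simpa [add_comm M, hg _] using ih r (by omega)

namespace DirichletCharacter

lemma norm_sum_Icc_le_natCast {M : ℕ} (χ : DirichletCharacter ℂ M) (n : ℕ) :
    ‖∑ k ∈ Finset.Icc 1 n, χ (k : ZMod M)‖ ≤ n := by
  simpa using norm_sum_le_of_le (Finset.Icc 1 n) fun k _ ↦ χ.norm_le_one (k : ZMod M)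

lemma norm_sum_Icc_le_level {M : ℕ} [NeZero M] {χ : DirichletCharacter ℂ M} (hχ : χ ≠ 1)
    (n : ℕ) : ‖∑ k ∈ Finset.Icc 1 n, χ (k : ZMod M)‖ ≤ M := by
  have hshift : ∑ k ∈ Finset.Icc 1 n, χ (k : ZMod M) =
      ∑ k ∈ Finset.range n, χ ((k : ZMod M) + 1) := by
    rw [← Finset.Ico_add_one_right_eq_Icc, Finset.sum_Ico_eq_sum_range]
    simp [add_comm]
  rw [hshift]
  refine norm_sum_range_le_of_periodic (NeZero.pos M) (fun k ↦ by simp) ?_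
    (fun k ↦ χ.norm_le_one _) n
  rw [← χ.sum_eq_zero_of_ne_one hχ, ← Equiv.sum_comp (Equiv.addRight (1 : ZMod M))]
  refine Finset.sum_nbij' (fun k ↦ (k : ZMod M)) ZMod.val ?_ ?_ ?_ ?_ ?_
  · simp
  · exact fun a _ ↦ Finset.mem_range.mpr a.val_lt
  · exact fun k hk ↦ ZMod.val_cast_of_lt (Finset.mem_range.mp hk)
  · simp
  · simp

lemma norm_sum_Icc_floor_le {M : ℕ} [NeZero M] {χ : DirichletCharacter ℂ M} (hχ : χ ≠ 1)
    {δ : ℝ} (hδ : 0 ≤ δ) (hδ1 : δ ≤ 1) {t : ℝ} (ht : 0 < t) :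
    ‖∑ k ∈ Finset.Icc 1 ⌊t⌋₊, χ (k : ZMod M)‖ ≤ (M : ℝ) ^ δ * t ^ (1 - δ) := by
  set S := ‖∑ k ∈ Finset.Icc 1 ⌊t⌋₊, χ (k : ZMod M)‖
  have hS : 0 ≤ S := norm_nonneg _
  calc S = S ^ δ * S ^ (1 - δ) := by
        rw [← Real.rpow_add_of_nonneg hS hδ (sub_nonneg.mpr hδ1)]; simp
    _ ≤ (M : ℝ) ^ δ * t ^ (1 - δ) := by
        gcongr
        · exact norm_sum_Icc_le_level hχ _
        · exact (norm_sum_Icc_le_natCast χ _).trans (Nat.floor_le ht.le)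

open MeasureTheory Filter in
lemma norm_LFunction_ofReal_le {M : ℕ} [NeZero M] {χ : DirichletCharacter ℂ M} (hχ : χ ≠ 1)
    {δ : ℝ} (hδ : 0 < δ) (hδ1 : δ ≤ 1) {s : ℝ} (hs : 1 < s) :
    ‖LFunction χ s‖ ≤ s * ((M : ℝ) ^ δ / δ) := by
  have hs' : 1 < (s : ℂ).re := by simpa
  rw [LFunction_eq_LSeries χ hs', LSeries_eq_mul_integral _ zero_le_one hs'
    (ZMod.LSeriesSummable_of_one_lt_re χ hs')
    (Asymptotics.isBigO_of_le _ fun n ↦ by simpa using norm_sum_Icc_le_natCast χ n), norm_mul,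
    Complex.norm_of_nonneg (by linarith)]
  gcongr
  have hint : IntegrableOn (fun t : ℝ ↦ (M : ℝ) ^ δ * t ^ (-δ - s)) (Set.Ioi 1) :=
    (integrableOn_Ioi_rpow_of_lt (by linarith) one_pos).const_mul _
  refine (norm_integral_le_of_norm_le hint ?_).trans ?_
  · refine (ae_restrict_iff' measurableSet_Ioi).mpr (.of_forall fun t ht ↦ ?_)
    have ht0 : 0 < t := one_pos.trans ht
    rw [norm_mul, Complex.norm_cpow_eq_rpow_re_of_pos ht0,
      show (-((s : ℂ) + 1)).re = -(s + 1) by simp]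
    calc _ ≤ (M : ℝ) ^ δ * t ^ (1 - δ) * t ^ (-(s + 1)) := by
          gcongr
          exact norm_sum_Icc_floor_le hχ hδ.le hδ1 ht0
      _ = (M : ℝ) ^ δ * t ^ (-δ - s) := by
          rw [mul_assoc, ← Real.rpow_add ht0]; ring_nf
  · rw [integral_const_mul, integral_Ioi_rpow_of_lt (by linarith) one_pos, Real.one_rpow,
      div_eq_mul_one_div ((M : ℝ) ^ δ), neg_div, ← div_neg]
    gcongr
    linarith

open Filter Topology in
lemma norm_LFunction_one_le_of_le_one {M : ℕ} [NeZero M] {χ : DirichletCharacter ℂ M}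
    (hχ : χ ≠ 1) {δ : ℝ} (hδ : 0 < δ) (hδ1 : δ ≤ 1) :
    ‖LFunction χ 1‖ ≤ (M : ℝ) ^ δ / δ := by
  have hcont : Continuous fun s : ℝ ↦ ‖LFunction χ s‖ :=
    ((differentiable_LFunction hχ).continuous.comp Complex.continuous_ofReal).norm
  have hleft := (hcont.tendsto 1).mono_left (nhdsWithin_le_nhds (s := Set.Ioi 1))
  have hright : Tendsto (fun s : ℝ ↦ s * ((M : ℝ) ^ δ / δ)) (𝓝[>] 1) (𝓝 ((M : ℝ) ^ δ / δ)) := by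
    have : Continuous fun s : ℝ ↦ s * ((M : ℝ) ^ δ / δ) := by fun_prop
    simpa using (this.tendsto 1).mono_left (nhdsWithin_le_nhds (s := Set.Ioi 1))
  simpa using le_of_tendsto_of_tendsto hleft hright
    (eventually_mem_nhdsWithin.mono fun s hs ↦ norm_LFunction_ofReal_le hχ hδ hδ1 hs)

lemma exists_norm_LFunction_one_le {δ : ℝ} (hδ : 0 < δ) :
    ∃ K : ℝ, 0 < K ∧ ∀ (M : ℕ) [NeZero M] (χ : DirichletCharacter ℂ M), χ ≠ 1 →
      ‖LFunction χ 1‖ ≤ K * (M : ℝ) ^ δ := by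
  have hpos : 0 < min δ 1 := lt_min hδ one_pos
  refine ⟨(min δ 1)⁻¹, inv_pos.mpr hpos, fun M _ χ hχ ↦ ?_⟩
  refine (norm_LFunction_one_le_of_le_one hχ hpos (min_le_right _ _)).trans ?_
  rw [div_eq_inv_mul]
  gcongr
  · exact_mod_cast NeZero.one_le
  · exact min_le_left _ _

lemma norm_prod_one_sub_mul_inv_le {M : ℕ} (χ : DirichletCharacter ℂ M) (S : Finset ℕ) :
    ‖∏ p ∈ S, (1 - χ (p : ZMod M) * (p : ℂ)⁻¹)‖ ≤ 2 ^ S.card := by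
  rw [norm_prod, ← Finset.prod_const]
  refine Finset.prod_le_prod (fun _ _ ↦ norm_nonneg _) fun p _ ↦ ?_
  calc ‖1 - χ (p : ZMod M) * (p : ℂ)⁻¹‖ ≤ ‖(1 : ℂ)‖ + ‖χ (p : ZMod M) * (p : ℂ)⁻¹‖ :=
        norm_sub_le _ _
    _ ≤ 1 + 1 * 1 := by
        rw [norm_mul, norm_one, norm_inv, Complex.norm_natCast]
        gcongr
        · exact χ.norm_le_one _
        · exact Nat.cast_inv_le_one p
    _ = 2 := by norm_num

lemma not_isPrimitive_of_forall_isSquare {M d : ℕ} [NeZero M] {χ : DirichletCharacter ℂ M}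
    (hχ : χ ^ 2 = 1) (hd : d ∣ M) (hdM : d < M)
    (h : ∀ t : ℤ, IsSquare (1 + d * t : ZMod M)) : ¬ χ.IsPrimitive := by
  intro hprim
  have hfac : χ.FactorsThrough d := by
    refine (factorsThrough_iff_ker_unitsMap hd).mpr fun u hu ↦ ?_
    obtain ⟨n, hn⟩ := ZMod.intCast_surjective (u : ZMod M)
    have hn1 : ((1 : ℤ) : ZMod d) = (n : ZMod d) := by
      have := congrArg Units.val (MonoidHom.mem_ker.mp hu)
      rw [ZMod.unitsMap_val, ← hn, ZMod.cast_intCast hd] at this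
      simpa using this.symm
    obtain ⟨t, ht⟩ := (ZMod.intCast_eq_intCast_iff_dvd_sub _ _ _).mp hn1
    obtain ⟨y, hy⟩ := h t
    have huy : (u : ZMod M) = y * y := by
      rw [← hy, ← hn, eq_add_of_sub_eq' ht]; push_cast; ring
    have hyu : IsUnit y := isUnit_of_mul_isUnit_left (huy ▸ u.isUnit)
    refine MonoidHom.mem_ker.mpr (Units.ext ?_)
    rw [MulChar.coe_toUnitHom, huy, map_mul, ← pow_two, ← MulChar.pow_apply' _ two_ne_zero, hχ,
      MulChar.one_apply hyu, Units.val_one]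
  exact absurd ((hprim.symm.le).trans (Nat.sInf_le hfac)) (not_le.mpr hdM)

lemma IsPrimitive.not_sq_dvd_of_odd {M p : ℕ} [NeZero M] {χ : DirichletCharacter ℂ M}
    (hprim : χ.IsPrimitive) (hχ : χ ^ 2 = 1) (hp : _root_.Odd p) (hp1 : 1 < p) : ¬ p ^ 2 ∣ M := by
  rintro ⟨e, he⟩
  have hM := NeZero.pos M
  refine not_isPrimitive_of_forall_isSquare (d := p * e) hχ ⟨p, by rw [he]; ring⟩ ?_
    (fun t ↦ ?_) hprim
  · have : 0 < p * e := Nat.pos_of_ne_zero fun h ↦ by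
      rw [he, pow_two, mul_assoc, h] at hM; simp at hM
    nlinarith
  · obtain ⟨q, hq⟩ := hp
    have h0 : (p : ZMod M) ^ 2 * e = 0 := by
      rw [← Nat.cast_pow, ← Nat.cast_mul, ← he, ZMod.natCast_self]
    have hq' : (p : ZMod M) = 2 * q + 1 := by exact_mod_cast congrArg (Nat.cast (R := ZMod M)) hq
    refine ⟨1 + p * e * t * (q + 1), ?_⟩
    push_cast
    linear_combination (-(t : ZMod M) - e * t ^ 2 * (q + 1) ^ 2) * h0 + p * e * t * hq'

lemma IsPrimitive.not_sixteen_dvd {M : ℕ} [NeZero M] {χ : DirichletCharacter ℂ M}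
    (hprim : χ.IsPrimitive) (hχ : χ ^ 2 = 1) : ¬ 16 ∣ M := by
  rintro ⟨e, he⟩
  have hM := NeZero.pos M
  refine not_isPrimitive_of_forall_isSquare (d := 8 * e) hχ ⟨2, by rw [he]; ring⟩ (by omega)
    (fun t ↦ ?_) hprim
  have h0 : (16 : ZMod M) * e = 0 := by
    rw [← Nat.cast_ofNat, ← Nat.cast_mul, ← he, ZMod.natCast_self]
  refine ⟨1 + 4 * e * t, ?_⟩
  push_cast
  linear_combination (-(e : ZMod M) * t ^ 2) * h0

lemma IsPrimitive.level_dvd_eight_mul_prod {M : ℕ} [NeZero M] {χ : DirichletCharacter ℂ M}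
    (hprim : χ.IsPrimitive) (hχ : χ ^ 2 = 1) {S : Finset ℕ} (hS : M.primeFactors ⊆ S) :
    M ∣ 8 * ∏ p ∈ S, p := by
  refine (Nat.dvd_iff_prime_pow_dvd_dvd _ _).mpr fun p k hp hk ↦ ?_
  rcases hp.eq_two_or_odd' with rfl | hodd
  · have hk3 : k ≤ 3 := by
      by_contra! h
      exact hprim.not_sixteen_dvd hχ ((pow_dvd_pow 2 h).trans hk)
    exact (pow_dvd_pow 2 hk3).trans (Dvd.intro _ rfl)
  · have hk1 : k ≤ 1 := by
      by_contra! h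
      exact hprim.not_sq_dvd_of_odd hχ hodd hp.one_lt ((pow_dvd_pow p h).trans hk)
    interval_cases k
    · simp
    · have hpM : p ∈ M.primeFactors :=
        Nat.mem_primeFactors.mpr ⟨hp, by simpa using hk, NeZero.ne M⟩
      simpa using (Finset.dvd_prod_of_mem (fun p ↦ p) (hS hpM)).mul_left 8

end DirichletCharacter

lemma eight_mul_prod_ne_zero {S : Finset ℕ} (hS : ∀ p ∈ S, p.Prime) : 8 * ∏ p ∈ S, p ≠ 0 :=
  mul_ne_zero (by norm_num) (Finset.prod_ne_zero_iff.mpr fun p hp ↦ (hS p hp).ne_zero)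

lemma eight_mul_prod_dvd {S : Finset ℕ} (hS : ∀ p ∈ S, p.Prime) {z : ℕ} (h16 : 16 ∣ z)
    (h : ∀ p ∈ S, p ∣ z) : 8 * ∏ p ∈ S, p ∣ z := by
  have hodd : 16 * ∏ p ∈ S.erase 2, p ∣ z := by
    refine Nat.Coprime.mul_dvd_of_dvd_of_dvd ?_ h16 ?_
    · refine Nat.Coprime.prod_right fun p hp ↦ ?_
      obtain ⟨hp2, hpS⟩ := Finset.mem_erase.mp hp
      exact Nat.Coprime.pow_left 4 ((Nat.coprime_primes Nat.prime_two (hS p hpS)).mpr hp2.symm)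
    · exact Finset.prod_primes_dvd _ (fun p hp ↦ (hS p (Finset.mem_of_mem_erase hp)).prime)
        fun p hp ↦ h p (Finset.mem_of_mem_erase hp)
  refine Dvd.dvd.trans ?_ hodd
  by_cases h2 : 2 ∈ S
  · rw [← Finset.mul_prod_erase S _ h2, ← mul_assoc, show 8 * 2 = 16 from rfl]
  · rw [Finset.erase_eq_of_notMem h2]
    exact Nat.mul_dvd_mul_right (by norm_num) _

lemma card_units_sq_eq_one_le {S : Finset ℕ} (hS : ∀ p ∈ S, p.Prime) :
    Nat.card {u : (ZMod (8 * ∏ p ∈ S, p))ˣ // u ^ 2 = 1} ≤ 16 * 2 ^ S.card := by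
  set N := 8 * ∏ p ∈ S, p
  have : NeZero N := ⟨eight_mul_prod_ne_zero hS⟩
  let f : {u : (ZMod N)ˣ // u ^ 2 = 1} → ZMod 16 × S.powerset := fun u ↦
    (((u.1 : ZMod N).val : ZMod 16),
      ⟨S.filter fun p ↦ ((u.1 : ZMod N).val : ZMod p) = 1, by simp⟩)
  have hsq (u : {u : (ZMod N)ˣ // u ^ 2 = 1}) (p : ℕ) (hp : p ∈ S) :
      ((u.1 : ZMod N).val : ZMod p) = 1 ∨ ((u.1 : ZMod N).val : ZMod p) = -1 := by
    have : Fact p.Prime := ⟨hS p hp⟩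
    have hpN : p ∣ N := (Finset.dvd_prod_of_mem (fun p ↦ p) hp).mul_left 8
    have h : ((u.1 : ZMod N).val : ZMod N) * (u.1 : ZMod N).val = 1 := by
      rw [ZMod.natCast_zmod_val, ← pow_two, ← Units.val_pow_eq_pow_val, u.2, Units.val_one]
    have h' := congrArg (ZMod.castHom hpN (ZMod p)) h
    rwa [map_mul, map_natCast, map_one, mul_self_eq_one_iff] at h'
  have hf : Function.Injective f := by
    intro u v huv
    obtain ⟨h16, hfil⟩ := Prod.ext_iff.mp huv
    have hfil' := Subtype.ext_iff.mp hfil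
    refine Subtype.ext (Units.ext ?_)
    rw [← ZMod.natCast_zmod_val (u.1 : ZMod N), ← ZMod.natCast_zmod_val (v.1 : ZMod N)]
    have key (p : ℕ) : p ∣ ((v.1 : ZMod N).val - (u.1 : ZMod N).val : ℤ).natAbs ↔
        ((u.1 : ZMod N).val : ZMod p) = ((v.1 : ZMod N).val : ZMod p) := by
      rw [← Int.natCast_dvd, ← ZMod.intCast_eq_intCast_iff_dvd_sub]; simp
    refine (key N).mp (eight_mul_prod_dvd hS ((key 16).mpr h16) fun p hp ↦ (key p).mpr ?_)
    have hiff : ((u.1 : ZMod N).val : ZMod p) = 1 ↔ ((v.1 : ZMod N).val : ZMod p) = 1 := by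
      have := Finset.ext_iff.mp hfil' p
      simpa only [f, Finset.mem_filter, hp, true_and] using this
    rcases hsq u p hp with h | h
    · rw [h, hiff.mp h]
    · rcases hsq v p hp with h' | h'
      · rw [h', hiff.mpr h']
      · rw [h, h']
  have h := Nat.card_le_card_of_injective f hf
  rw [Nat.card_prod, Nat.card_zmod, Nat.card_eq_fintype_card (α := S.powerset),
    Fintype.card_coe, Finset.card_powerset] at h
  exact h

lemma DirichletCharacter.card_sq_eq_one_le {S : Finset ℕ} (hS : ∀ p ∈ S, p.Prime) :
    Nat.card {ψ : DirichletCharacter ℂ (8 * ∏ p ∈ S, p) // ψ ^ 2 = 1} ≤ 16 * 2 ^ S.card := by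
  have : NeZero (8 * ∏ p ∈ S, p) := ⟨eight_mul_prod_ne_zero hS⟩
  let e := (DirichletCharacter.mulEquiv_units ℂ (8 * ∏ p ∈ S, p)).some
  refine le_of_eq_of_le (Nat.card_congr (e.toEquiv.subtypeEquiv fun ψ ↦ ?_))
    (card_units_sq_eq_one_le hS)
  simp [← map_pow]

/-- Nontrivial primitive quadratic Dirichlet characters whose conductor is supported on `S`. -/
abbrev QuadraticCharacterSupportedOn (S : Finset ℕ) : Type :=
  {x : (M : ℕ) × DirichletCharacter ℂ M //
    x.1 ≠ 0 ∧ x.2.IsPrimitive ∧ x.2 ^ 2 = 1 ∧ x.2 ≠ 1 ∧ x.1.primeFactors ⊆ S}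

namespace QuadraticCharacterSupportedOn

lemma level_dvd {S : Finset ℕ} (x : QuadraticCharacterSupportedOn S) :
    x.1.1 ∣ 8 * ∏ p ∈ S, p :=
  have : NeZero x.1.1 := ⟨x.2.1⟩
  x.2.2.1.level_dvd_eight_mul_prod x.2.2.2.1 x.2.2.2.2.2

/-- The lift of a character to the common modulus `8 * ∏ p ∈ S, p`. -/
noncomputable def lift {S : Finset ℕ} (x : QuadraticCharacterSupportedOn S) :
    {ψ : DirichletCharacter ℂ (8 * ∏ p ∈ S, p) // ψ ^ 2 = 1} :=
  ⟨DirichletCharacter.changeLevel x.level_dvd x.1.2, by rw [← map_pow, x.2.2.2.1, map_one]⟩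

lemma lift_injective {S : Finset ℕ} (hS : ∀ p ∈ S, p.Prime) :
    Function.Injective (lift (S := S)) := by
  have : NeZero (8 * ∏ p ∈ S, p) := ⟨eight_mul_prod_ne_zero hS⟩
  rintro x y hxy
  have h : DirichletCharacter.changeLevel x.level_dvd x.1.2 =
      DirichletCharacter.changeLevel y.level_dvd y.1.2 := Subtype.ext_iff.mp hxy
  have hlevel : x.1.1 = y.1.1 := by
    have := congrArg DirichletCharacter.conductor h
    rw [DirichletCharacter.conductor_changeLevel, DirichletCharacter.conductor_changeLevel] at this
    exact x.2.2.1.symm.trans (this.trans y.2.2.1)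
  obtain ⟨⟨M, χ⟩, hx⟩ := x
  obtain ⟨⟨M', χ'⟩, hy⟩ := y
  obtain rfl : M = M' := hlevel
  obtain rfl : χ = χ' := DirichletCharacter.changeLevel_injective _ h
  rfl

lemma finite_and_card_le {S : Finset ℕ} (hS : ∀ p ∈ S, p.Prime) :
    Finite (QuadraticCharacterSupportedOn S) ∧
      Nat.card (QuadraticCharacterSupportedOn S) ≤ 16 * 2 ^ S.card := by
  have : NeZero (8 * ∏ p ∈ S, p) := ⟨eight_mul_prod_ne_zero hS⟩
  exact ⟨Finite.of_injective _ (lift_injective hS),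
    (Nat.card_le_card_of_injective _ (lift_injective hS)).trans
      (DirichletCharacter.card_sq_eq_one_le hS)⟩

end QuadraticCharacterSupportedOn


/-- For every `ε > 0` and every positive integer `m` there is a constant
`C(ε, m)` such that for every finite set `S₀` of primes,
`∑_χ |L^{S₀}(1, χ)|^m ≤ C(ε, m) · ∏_{p ∈ S₀} p^ε`, where the sum runs over all nontrivial
primitive quadratic Dirichlet characters `χ` whose conductor is divisible only by primes of
`S₀` (there are finitely many such `χ`), and
`L^{S₀}(1, χ) = L(1, χ) · ∏_{p ∈ S₀} (1 − χ(p) p⁻¹)` is the value at `s = 1` of the Dirichlet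
`L`-function of `χ` with the Euler factors at the primes of `S₀` removed. -/
theorem quadratic_character_L_value_sum_bound (ε : ℝ) (hε : 0 < ε) (m : ℕ) (hm : 0 < m) :
    ∃ C : ℝ, 0 < C ∧ ∀ S₀ : Finset ℕ, (∀ p ∈ S₀, p.Prime) →
      Finite {x : (M : ℕ) × DirichletCharacter ℂ M //
        x.1 ≠ 0 ∧ x.2.IsPrimitive ∧ x.2 ^ 2 = 1 ∧ x.2 ≠ 1 ∧ x.1.primeFactors ⊆ S₀} ∧
      (∑' x : {x : (M : ℕ) × DirichletCharacter ℂ M //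
          x.1 ≠ 0 ∧ x.2.IsPrimitive ∧ x.2 ^ 2 = 1 ∧ x.2 ≠ 1 ∧ x.1.primeFactors ⊆ S₀},
          ‖(@DirichletCharacter.LFunction x.1.1 ⟨x.2.1⟩ x.1.2 1) *
              ∏ p ∈ S₀, (1 - x.1.2 (p : ZMod x.1.1) * (p : ℂ)⁻¹)‖ ^ m) ≤
        C * ∏ p ∈ S₀, (p : ℝ) ^ ε := by
  obtain ⟨K, hK, hL⟩ := DirichletCharacter.exists_norm_LFunction_one_le
    (show 0 < ε / (2 * m) by positivity)
  obtain ⟨C, hC, hCS⟩ := exists_const_pow_card_le_prod_rpow (2 ^ (m + 1)) (one_le_pow₀ one_le_two)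
    (half_pos hε)
  refine ⟨16 * (K * 8 ^ (ε / (2 * m))) ^ m * C, by positivity, fun S₀ hS ↦ ?_⟩
  obtain ⟨hfin, hcard⟩ := QuadraticCharacterSupportedOn.finite_and_card_le hS
  refine ⟨hfin, ?_⟩
  have := Fintype.ofFinite (QuadraticCharacterSupportedOn S₀)
  set P := ∏ p ∈ S₀, (p : ℝ) ^ (ε / 2) with hP
  have hP0 : 0 ≤ P := by positivity
  have hPP : P * P = ∏ p ∈ S₀, (p : ℝ) ^ ε := by
    rw [hP, ← Finset.prod_mul_distrib]
    refine Finset.prod_congr rfl fun p hp ↦ ?_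
    rw [← Real.rpow_add (by exact_mod_cast (hS p hp).pos), add_halves]
  have hpow : (((8 * ∏ p ∈ S₀, p : ℕ) : ℝ) ^ (ε / (2 * m))) ^ m =
      (8 ^ (ε / (2 * m))) ^ m * P := by
    have hm' : (m : ℝ) ≠ 0 := by exact_mod_cast hm.ne'
    push_cast
    rw [Real.mul_rpow (by norm_num) (by positivity), mul_pow, hP,
      ← Real.finsetProd_rpow _ _ fun _ _ ↦ by positivity, ← Finset.prod_pow]
    congr 1
    refine Finset.prod_congr rfl fun p _ ↦ ?_
    rw [← Real.rpow_mul_natCast (by positivity)]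
    congr 1
    field_simp
  have hterm (x : QuadraticCharacterSupportedOn S₀) :
      ‖(@DirichletCharacter.LFunction x.1.1 ⟨x.2.1⟩ x.1.2 1) *
        ∏ p ∈ S₀, (1 - x.1.2 (p : ZMod x.1.1) * (p : ℂ)⁻¹)‖ ^ m ≤
      (K * 8 ^ (ε / (2 * m))) ^ m * P * (2 ^ m) ^ S₀.card := by
    have : NeZero x.1.1 := ⟨x.2.1⟩
    calc _ ≤ (K * ((8 * ∏ p ∈ S₀, p : ℕ) : ℝ) ^ (ε / (2 * m)) * 2 ^ S₀.card) ^ m := by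
          rw [norm_mul]
          gcongr
          · refine (hL x.1.1 x.1.2 x.2.2.2.2.1).trans ?_
            gcongr
            exact Nat.le_of_dvd (eight_mul_prod_ne_zero hS).pos x.level_dvd
          · exact DirichletCharacter.norm_prod_one_sub_mul_inv_le x.1.2 S₀
      _ = _ := by rw [mul_pow, mul_pow, hpow, mul_pow, pow_right_comm]; ring
  rw [tsum_fintype]
  calc _ ≤ ∑ _x : QuadraticCharacterSupportedOn S₀,
          (K * 8 ^ (ε / (2 * m))) ^ m * P * (2 ^ m) ^ S₀.card :=
        Finset.sum_le_sum fun x _ ↦ hterm x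
    _ = Nat.card (QuadraticCharacterSupportedOn S₀) *
          ((K * 8 ^ (ε / (2 * m))) ^ m * P * (2 ^ m) ^ S₀.card) := by
        simp [Nat.card_eq_fintype_card]
    _ ≤ (16 * 2 ^ S₀.card) * ((K * 8 ^ (ε / (2 * m))) ^ m * P * (2 ^ m) ^ S₀.card) := by
        gcongr
        exact_mod_cast hcard
    _ = 16 * (K * 8 ^ (ε / (2 * m))) ^ m * P * (2 ^ (m + 1)) ^ S₀.card := by
        rw [pow_succ 2 m, mul_pow (2 ^ m) 2]; ring
    _ ≤ 16 * (K * 8 ^ (ε / (2 * m))) ^ m * P * (C * P) := by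
        gcongr
        exact hCS S₀ fun p hp ↦ (hS p hp).one_le
    _ = 16 * (K * 8 ^ (ε / (2 * m))) ^ m * C * ∏ p ∈ S₀, (p : ℝ) ^ ε := by
        rw [← hPP]; ring
end

section
/- Let φ : ℝ → ℝ be an even Schwartz function whose Fourier transform φ̂ has compact support. There exists a constant C (depending on φ) such that for all real c ≥ 3, | ∑_{p prime} (2 log p)/(p · log c) · φ̂(2 log p / log c) − (1/2) φ(0) | ≤ C / log c. -/
open scoped FourierTransform

namespace Mertens

/-- The sum of `log p / p` over the primes `p ≤ n`. -/
noncomputable def primeLogSum (n : ℕ) : ℝ :=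
  ∑ p ∈ Nat.primesLE n, Real.log p / p

theorem log_factorial_eq_sum_primesLE (n : ℕ) :
    Real.log (n.factorial) =
      ∑ p ∈ Nat.primesLE n, (n.factorial.factorization p : ℝ) * Real.log p := by
  rw [Real.log_nat_eq_sum_factorization, Finsupp.sum_of_support_subset]
  · intro p hp
    have hp' := Nat.prime_of_mem_primeFactors hp
    exact Nat.mem_primesLE.2
      ⟨(hp'.dvd_factorial).1 (Nat.dvd_of_mem_primeFactors hp), hp'⟩
  · simp

theorem div_le_factorization_factorial {p : ℕ} (hp : p.Prime) (n : ℕ) :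
    n / p ≤ n.factorial.factorization p := by
  have h : (p * (n / p)).factorial ∣ n.factorial :=
    Nat.factorial_dvd_factorial (Nat.mul_div_le n p)
  have h1 := (Nat.factorization_le_iff_dvd (Nat.factorial_ne_zero _)
    (Nat.factorial_ne_zero _)).2 h p
  rw [Nat.factorization_factorial_mul hp] at h1
  omega

theorem sub_one_mul_factorization_factorial_le {p : ℕ} (hp : p.Prime) (n : ℕ) :
    (p - 1) * n.factorial.factorization p ≤ n := by
  rw [Nat.sub_one_mul_factorization_factorial hp]
  exact Nat.sub_le _ _

theorem primeLogSum_le {n : ℕ} (hn : 0 < n) : primeLogSum n ≤ Real.log n + Real.log 4 := by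
  have hn' : (0 : ℝ) < n := by exact_mod_cast hn
  have h1 : (n : ℝ) * primeLogSum n - Chebyshev.theta n ≤ Real.log n.factorial := by
    rw [log_factorial_eq_sum_primesLE, Chebyshev.theta_eq_sum_primesLE_log, primeLogSum,
      Finset.mul_sum, ← Finset.sum_sub_distrib]
    refine Finset.sum_le_sum fun p hp ↦ ?_
    have hpp := Nat.prime_of_mem_primesLE hp
    have hp0 : (0 : ℝ) < p := by exact_mod_cast hpp.pos
    have hlog : 0 ≤ Real.log p := Real.log_natCast_nonneg p
    have h2 : (n : ℝ) / p ≤ n.factorial.factorization p + 1 := by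
      have h3 : (n : ℝ) / p < (n / p : ℕ) + 1 := by
        rw [← Nat.floor_div_eq_div (K := ℝ)]
        exact Nat.lt_floor_add_one _
      have h4 : ((n / p : ℕ) : ℝ) ≤ n.factorial.factorization p := by
        exact_mod_cast div_le_factorization_factorial hpp n
      linarith
    have h5 := mul_le_mul_of_nonneg_right h2 hlog
    have h6 : (n : ℝ) * (Real.log p / p) = n / p * Real.log p := by ring
    linarith
  have h2 : Real.log n.factorial ≤ n * Real.log n := by
    rw [← Real.log_pow]
    exact Real.log_le_log (by exact_mod_cast Nat.factorial_pos n)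
      (by exact_mod_cast Nat.factorial_le_pow n)
  have h3 := Chebyshev.theta_le_log4_mul_x hn'.le
  have h4 : (n : ℝ) * primeLogSum n ≤ n * (Real.log n + Real.log 4) := by linarith
  exact le_of_mul_le_mul_left h4 hn'

theorem summable_log_div_mul_sub_one :
    Summable fun n : ℕ ↦ Real.log n / (n * (n - 1 : ℝ)) := by
  have h : Summable fun n : ℕ ↦ 4 * ((n : ℝ) ^ (3 / 2 : ℝ))⁻¹ :=
    (Real.summable_nat_rpow_inv.2 (by norm_num)).mul_left 4
  refine h.of_norm_bounded fun n ↦ ?_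
  rcases Nat.lt_or_ge n 2 with hn | hn
  · interval_cases n <;> simp
  have hn' : (2 : ℝ) ≤ n := by exact_mod_cast hn
  have h0 : (0 : ℝ) < n := by linarith
  have hlog : Real.log n ≤ (n : ℝ) ^ (1 / 2 : ℝ) / (1 / 2) :=
    Real.log_le_rpow_div h0.le (by norm_num)
  rw [Real.norm_of_nonneg (div_nonneg (Real.log_natCast_nonneg n) (by nlinarith)),
    div_le_iff₀ (by nlinarith), ← div_eq_mul_inv, div_mul_eq_mul_div,
    le_div_iff₀ (by positivity)]
  have h2 : (n : ℝ) ^ (1 / 2 : ℝ) * (n : ℝ) ^ (3 / 2 : ℝ) = n ^ 2 := by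
    rw [← Real.rpow_add h0, ← Real.rpow_natCast]; norm_num
  calc Real.log n * (n : ℝ) ^ (3 / 2 : ℝ)
      ≤ (n : ℝ) ^ (1 / 2 : ℝ) / (1 / 2) * (n : ℝ) ^ (3 / 2 : ℝ) := by gcongr
    _ = 2 * n ^ 2 := by rw [← h2]; ring
    _ ≤ 4 * (n * (n - 1)) := by nlinarith

theorem exists_le_primeLogSum :
    ∃ K : ℝ, ∀ n : ℕ, 0 < n → Real.log n - K ≤ primeLogSum n := by
  refine ⟨1 + ∑' n : ℕ, Real.log n / (n * (n - 1 : ℝ)), fun n hn ↦ ?_⟩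
  have hn' : (0 : ℝ) < n := by exact_mod_cast hn
  have h1 : n * Real.log n - n ≤ Real.log n.factorial := by
    have := Stirling.le_log_factorial_stirling hn.ne'
    have h2 : 0 ≤ Real.log (2 * Real.pi) :=
      Real.log_nonneg (by linarith [Real.pi_gt_three])
    have := Real.log_natCast_nonneg n
    linarith
  have h2 : Real.log n.factorial ≤
      n * (primeLogSum n + ∑ p ∈ Nat.primesLE n, Real.log p / (p * (p - 1 : ℝ))) := by
    rw [log_factorial_eq_sum_primesLE, primeLogSum, ← Finset.sum_add_distrib, Finset.mul_sum]
    refine Finset.sum_le_sum fun p hp ↦ ?_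
    have hpp := Nat.prime_of_mem_primesLE hp
    have hp2 : (2 : ℝ) ≤ p := by exact_mod_cast hpp.two_le
    have hlog : 0 ≤ Real.log p := Real.log_natCast_nonneg p
    have h3 : ((p : ℝ) - 1) * n.factorial.factorization p ≤ n := by
      have := sub_one_mul_factorization_factorial_le hpp n
      rw [← Nat.cast_pred hpp.pos]
      exact_mod_cast this
    have h4 : (n.factorial.factorization p : ℝ) ≤ n / (p - 1) := by
      rw [le_div_iff₀ (by linarith)]; linarith
    calc _ ≤ n / (p - 1 : ℝ) * Real.log p := by gcongr
      _ = _ := by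
        have : (p : ℝ) - 1 ≠ 0 := by linarith
        have : (p : ℝ) ≠ 0 := by linarith
        field_simp
        ring
  have h3 : ∑ p ∈ Nat.primesLE n, Real.log p / (p * (p - 1 : ℝ)) ≤
      ∑' n : ℕ, Real.log n / (n * (n - 1 : ℝ)) := by
    refine summable_log_div_mul_sub_one.sum_le_tsum _ fun k _ ↦ ?_
    rcases Nat.eq_zero_or_pos k with rfl | hk
    · simp
    have : (1 : ℝ) ≤ k := by exact_mod_cast hk
    exact div_nonneg (Real.log_natCast_nonneg k) (by nlinarith)
  have h4 : (n : ℝ) * (Real.log n - 1) ≤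
      n * (primeLogSum n + ∑ p ∈ Nat.primesLE n, Real.log p / (p * (p - 1 : ℝ))) := by linarith
  have := le_of_mul_le_mul_left h4 hn'
  linarith

/-- The first theorem of Mertens: the sum of `log p / p` over primes `p ≤ x` is `log x + O(1)`. -/
theorem exists_abs_primeLogSum_floor_sub_log_le :
    ∃ K : ℝ, ∀ x : ℝ, 1 ≤ x → |primeLogSum ⌊x⌋₊ - Real.log x| ≤ K := by
  obtain ⟨K, hK⟩ := exists_le_primeLogSum
  refine ⟨max (K + Real.log 2) (Real.log 4), fun x hx ↦ ?_⟩
  have hn : 0 < ⌊x⌋₊ := Nat.floor_pos.2 hx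
  have hn' : (1 : ℝ) ≤ ⌊x⌋₊ := by exact_mod_cast hn
  have h1 := hK _ hn
  have h2 := primeLogSum_le hn
  have h3 : Real.log ⌊x⌋₊ ≤ Real.log x :=
    Real.log_le_log (by linarith) (Nat.floor_le (by linarith))
  have h4 : Real.log x ≤ Real.log 2 + Real.log ⌊x⌋₊ := by
    rw [← Real.log_mul (by norm_num) (by linarith)]
    exact Real.log_le_log (by linarith) (by linarith [Nat.lt_floor_add_one x])
  rw [abs_le]
  constructor
  · linarith [le_max_left (K + Real.log 2) (Real.log 4)]
  · linarith [le_max_right (K + Real.log 2) (Real.log 4)]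

end Mertens

open MeasureTheory in
theorem integral_eq_two_smul_integral_Ioi_of_even {E : Type*} [NormedAddCommGroup E]
    [NormedSpace ℝ E] {f : ℝ → E} (hf : Integrable f) (heven : ∀ x, f (-x) = f x) :
    ∫ x, f x = (2 : ℝ) • ∫ x in Set.Ioi 0, f x := by
  have h1 : ∫ x in Set.Iic 0, f x = ∫ x in Set.Ioi 0, f x := by
    rw [← setIntegral_congr_fun measurableSet_Iic fun x _ ↦ heven x,
      integral_comp_neg_Iic, neg_zero]
  rw [← intervalIntegral.integral_Iic_add_Ioi hf.integrableOn hf.integrableOn, h1, two_smul]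

open MeasureTheory in
theorem intervalIntegral_indicator_Ici {E : Type*} [NormedAddCommGroup E]
    [NormedSpace ℝ E] (f : ℝ → E) {a b y : ℝ} (hay : a ≤ y) (hyb : y ≤ b) :
    ∫ v in a..b, (Set.Ici y).indicator f v = ∫ v in y..b, f v := by
  rw [intervalIntegral.integral_of_le (hay.trans hyb), intervalIntegral.integral_of_le hyb,
    setIntegral_indicator measurableSet_Ici]
  refine setIntegral_congr_set ?_
  have h : Set.Ioc y b = Set.Ioc a b ∩ Set.Ioi y := by
    ext v
    simp only [Set.mem_Ioc, Set.mem_inter_iff, Set.mem_Ioi]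
    exact ⟨fun h ↦ ⟨⟨hay.trans_lt h.1, h.2⟩, h.1⟩, fun h ↦ ⟨h.2, h.1.2⟩⟩
  rw [h]
  exact (Filter.EventuallyEq.refl _ _).inter Ioi_ae_eq_Ici.symm

/-- Partial summation for `log p / p` against a `C¹` function `F` vanishing beyond `R`. -/
theorem exists_norm_tsum_primes_log_div_sub_integral_le {F F' : ℝ → ℂ} {R : ℝ} (hR : 0 ≤ R)
    (hF : ∀ x, HasDerivAt F (F' x) x) (hF' : Continuous F') (hFR : ∀ x, R ≤ x → F x = 0) :
    ∃ C : ℝ, ∀ L : ℝ, 0 < L →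
      ‖(∑' p : Nat.Primes, (((2 * Real.log (p : ℕ)) / ((p : ℕ) * L) : ℝ) : ℂ) *
          F (2 * Real.log (p : ℕ) / L)) - ∫ v in 0..R, F v‖ ≤ C / L := by
  obtain ⟨K, hK⟩ := Mertens.exists_abs_primeLogSum_floor_sub_log_le
  obtain ⟨M, hM⟩ := (isCompact_Icc (a := (0 : ℝ)) (b := R)).exists_bound_of_continuousOn
    hF'.continuousOn
  refine ⟨2 * (K * M * R), fun L hL ↦ ?_⟩
  set N := ⌊Real.exp (R * L / 2)⌋₊
  have mem_iff : ∀ {p : ℕ}, p.Prime → ∀ v : ℝ,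
      (p ≤ ⌊Real.exp (v * L / 2)⌋₊ ↔ 2 * Real.log p / L ≤ v) := by
    intro p hp v
    have hp0 : (0 : ℝ) < p := by exact_mod_cast hp.pos
    rw [Nat.le_floor_iff (Real.exp_pos _).le, ← Real.log_le_iff_le_exp hp0, div_le_iff₀ hL,
      le_div_iff₀ two_pos, mul_comm]
  have htsum : (∑' p : Nat.Primes, (((2 * Real.log (p : ℕ)) / ((p : ℕ) * L) : ℝ) : ℂ) *
      F (2 * Real.log (p : ℕ) / L)) =
      ∑ p ∈ Nat.primesLE N, (((2 * Real.log p) / (p * L) : ℝ) : ℂ) *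
        F (2 * Real.log p / L) := by
    refine (tsum_subtype {p : ℕ | p.Prime} fun p : ℕ ↦
      (((2 * Real.log p) / (p * L) : ℝ) : ℂ) * F (2 * Real.log p / L)).trans ?_
    rw [tsum_eq_sum (s := Nat.primesLE N)]
    · exact Finset.sum_congr rfl fun p hp ↦
        Set.indicator_of_mem (s := {p : ℕ | p.Prime}) (Nat.prime_of_mem_primesLE hp) _
    · intro p hp
      by_cases hpp : p.Prime
      · rw [Set.indicator_of_mem (s := {p : ℕ | p.Prime}) hpp, hFR, mul_zero]
        by_contra! h
        exact hp (Nat.mem_primesLE.2 ⟨(mem_iff hpp R).2 h.le, hpp⟩)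
      · exact Set.indicator_of_notMem (s := {p : ℕ | p.Prime}) hpp _
  have hFy : ∀ p ∈ Nat.primesLE N, F (2 * Real.log p / L) =
      -∫ v in 0..R, (Set.Ici (2 * Real.log p / L)).indicator F' v := by
    intro p hp
    obtain ⟨hpN, hpp⟩ := Nat.mem_primesLE.1 hp
    rw [intervalIntegral_indicator_Ici _
      (div_nonneg (mul_nonneg two_pos.le (Real.log_natCast_nonneg p)) hL.le)
      ((mem_iff hpp R).1 hpN),
      intervalIntegral.integral_eq_sub_of_hasDerivAt (fun x _ ↦ hF x)
        (hF'.intervalIntegrable _ _), hFR R le_rfl]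
    ring
  have hInt : ∀ p ∈ Nat.primesLE N, IntervalIntegrable (fun v ↦ ((Real.log p / p : ℝ) : ℂ) *
      (Set.Ici (2 * Real.log p / L)).indicator F' v) MeasureTheory.volume 0 R := by
    intro p _
    have h := hF'.intervalIntegrable (μ := MeasureTheory.volume) 0 R
    exact IntervalIntegrable.const_mul
      ⟨h.1.indicator measurableSet_Ici, h.2.indicator measurableSet_Ici⟩ _
  have hpoint : ∀ v ∈ Set.uIcc 0 R, ∑ p ∈ Nat.primesLE N, ((Real.log p / p : ℝ) : ℂ) *
      (Set.Ici (2 * Real.log p / L)).indicator F' v =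
      (Mertens.primeLogSum ⌊Real.exp (v * L / 2)⌋₊ : ℂ) * F' v := by
    intro v hv
    rw [Set.uIcc_of_le hR] at hv
    have hle : ⌊Real.exp (v * L / 2)⌋₊ ≤ N :=
      Nat.floor_mono (Real.exp_le_exp.2 (by have := hv.2; gcongr))
    rw [Mertens.primeLogSum, Complex.ofReal_sum, Finset.sum_mul,
      ← Finset.sum_subset (Nat.primesLE_mono hle)]
    · refine Finset.sum_congr rfl fun p hp ↦ ?_
      obtain ⟨h1, h2⟩ := Nat.mem_primesLE.1 hp
      rw [Set.indicator_of_mem (s := Set.Ici _) ((mem_iff h2 v).1 h1)]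
    · intro p hp hp'
      have h2 := Nat.prime_of_mem_primesLE hp
      rw [Set.indicator_of_notMem, mul_zero]
      exact fun h ↦ hp' (Nat.mem_primesLE.2 ⟨(mem_iff h2 v).2 h, h2⟩)
  have hsum : ∑ p ∈ Nat.primesLE N, (((2 * Real.log p) / (p * L) : ℝ) : ℂ) *
      F (2 * Real.log p / L) =
      -((2 / L : ℝ) * ∫ v in 0..R, (Mertens.primeLogSum ⌊Real.exp (v * L / 2)⌋₊ : ℂ) * F' v) := by
    rw [← intervalIntegral.integral_congr hpoint, intervalIntegral.integral_finsetSum hInt,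
      Finset.mul_sum, ← Finset.sum_neg_distrib]
    refine Finset.sum_congr rfl fun p hp ↦ ?_
    rw [hFy p hp, intervalIntegral.integral_const_mul]
    push_cast
    ring
  have hparts : ∫ v in 0..R, F v =
      -((2 / L : ℝ) * ∫ v in 0..R, ((v * L / 2 : ℝ) : ℂ) * F' v) := by
    have h := intervalIntegral.integral_mul_deriv_eq_deriv_mul (a := 0) (b := R)
      (u := fun v : ℝ ↦ (v : ℂ)) (u' := fun _ ↦ 1) (v := F) (v' := F')
      (fun x _ ↦ Complex.ofRealCLM.hasDerivAt) (fun x _ ↦ hF x)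
      (continuous_const.intervalIntegrable _ _) (hF'.intervalIntegrable _ _)
    simp only [hFR R le_rfl, one_mul, Complex.ofReal_zero, zero_mul, mul_zero, sub_zero,
      zero_sub] at h
    rw [← intervalIntegral.integral_const_mul, ← neg_eq_iff_eq_neg, ← h]
    refine intervalIntegral.integral_congr fun v _ ↦ ?_
    have : (L : ℂ) ≠ 0 := by exact_mod_cast hL.ne'
    push_cast
    field_simp
  have hInt₁ : IntervalIntegrable
      (fun v ↦ (Mertens.primeLogSum ⌊Real.exp (v * L / 2)⌋₊ : ℂ) * F' v)
      MeasureTheory.volume 0 R := by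
    have h := IntervalIntegrable.sum (Nat.primesLE N) hInt
    refine h.congr fun v hv ↦ ?_
    rw [Finset.sum_apply]
    exact hpoint v (Set.uIoc_subset_uIcc hv)
  have hInt₂ : IntervalIntegrable (fun v ↦ ((v * L / 2 : ℝ) : ℂ) * F' v)
      MeasureTheory.volume 0 R :=
    Continuous.intervalIntegrable (by fun_prop) _ _
  rw [htsum, hsum, hparts, ← neg_sub', norm_neg, ← mul_sub,
    ← intervalIntegral.integral_sub hInt₁ hInt₂, norm_mul, Complex.norm_real,
    Real.norm_of_nonneg (by positivity)]
  have hbound : ‖∫ v in 0..R, ((Mertens.primeLogSum ⌊Real.exp (v * L / 2)⌋₊ : ℂ) * F' v -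
      ((v * L / 2 : ℝ) : ℂ) * F' v)‖ ≤ K * M * |R - 0| := by
    refine intervalIntegral.norm_integral_le_of_norm_le_const fun v hv ↦ ?_
    rw [Set.uIoc_of_le hR] at hv
    have h1 := hK (Real.exp (v * L / 2))
      (Real.one_le_exp (by have := hv.1; positivity))
    rw [Real.log_exp] at h1
    rw [← sub_mul, norm_mul, ← Complex.ofReal_sub, Complex.norm_real, Real.norm_eq_abs]
    exact mul_le_mul h1 (hM v ⟨hv.1.le, hv.2⟩) (norm_nonneg _) ((abs_nonneg _).trans h1)
  rw [sub_zero, abs_of_nonneg hR] at hbound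
  calc _ ≤ 2 / L * (K * M * R) := by gcongr
    _ = _ := by ring

/-- Let `φ : ℝ → ℝ` be an even Schwartz function whose Fourier transform `φ̂`
has compact support. There exists a constant `C` (depending on `φ`) such that for all real
`c ≥ 3`: `|∑_{p prime} (2 log p)/(p · log c) · φ̂(2 log p / log c) − (1/2) φ(0)| ≤ C / log c`. -/
theorem prime_squares_explicit_formula_contribution
    (φ : SchwartzMap ℝ ℝ)
    (heven : ∀ x : ℝ, φ (-x) = φ x)
    (hsupp : HasCompactSupport (𝓕 (fun x => (φ x : ℂ)))) :
    ∃ C : ℝ, ∀ c : ℝ, 3 ≤ c →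
      ‖(∑' p : Nat.Primes,
            (((2 * Real.log (p : ℕ)) / ((p : ℕ) * Real.log c) : ℝ) : ℂ) *
              𝓕 (fun x => (φ x : ℂ)) (2 * Real.log (p : ℕ) / Real.log c)) -
          (φ 0 : ℂ) / 2‖ ≤ C / Real.log c := by
  let f : SchwartzMap ℝ ℂ := SchwartzMap.postcompCLM Complex.ofRealCLM φ
  have hf : (fun x => (φ x : ℂ)) = f := rfl
  rw [hf, ← SchwartzMap.fourier_coe] at hsupp ⊢
  have hF_even : ∀ y, 𝓕 f (-y) = 𝓕 f y := by
    intro y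
    have h := Real.fourier_comp_linearIsometry (LinearIsometryEquiv.neg ℝ (E := ℝ)) (f : ℝ → ℂ) y
    have hcomp : (f : ℝ → ℂ) ∘ LinearIsometryEquiv.neg ℝ (E := ℝ) = f := by
      ext x
      exact congrArg Complex.ofReal (heven x)
    rw [hcomp] at h
    exact h.symm
  obtain ⟨R, hR, hFR⟩ : ∃ R : ℝ, 0 ≤ R ∧ ∀ x, R ≤ x → 𝓕 f x = 0 := by
    obtain ⟨R, hR, h⟩ := hsupp.exists_pos_le_norm
    exact ⟨R, hR.le, fun x hx ↦ h x (hx.trans (le_abs_self x))⟩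
  have hInt : ∫ v in 0..R, 𝓕 f v = (φ 0 : ℂ) / 2 := by
    have h1 : ∫ v, 𝓕 f v = (φ 0 : ℂ) := by
      have h := congrArg (fun g : SchwartzMap ℝ ℂ ↦ g 0)
        (FourierTransform.fourierInv_fourier_eq (F := SchwartzMap ℝ ℂ) f)
      simp only [SchwartzMap.fourierInv_coe, Real.fourierInv_eq] at h
      have h' : ∫ v, 𝓕 f v = f 0 := by simpa using h
      exact h'
    have h2 : ∫ v in Set.Ioi 0, 𝓕 f v = ∫ v in 0..R, 𝓕 f v := by
      rw [intervalIntegral.integral_of_le hR]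
      refine MeasureTheory.setIntegral_eq_of_subset_of_forall_sdiff_eq_zero measurableSet_Ioi
        Set.Ioc_subset_Ioi_self fun x hx ↦ hFR x ?_
      by_contra! h
      exact hx.2 ⟨hx.1, h.le⟩
    rw [← h1, integral_eq_two_smul_integral_Ioi_of_even (𝓕 f).integrable hF_even, h2]
    simp
  obtain ⟨C, hC⟩ := exists_norm_tsum_primes_log_div_sub_integral_le hR
    (fun x ↦ (𝓕 f).differentiableAt.hasDerivAt) (((𝓕 f).smooth 1).continuous_deriv le_rfl) hFR
  refine ⟨C, fun c hc ↦ ?_⟩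
  rw [← hInt]
  exact hC _ (Real.log_pos (by linarith))
end
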